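/- For v, w ∈ ℝ^N one has d̄(v, w) = 0 if and only if v = w or there exists j ∈ J with v ∈ I_j and w ∈ I_j. Consequently the quotient of ℝ^N identifying the points of each stitch I_j to a single point, with the distance induced by d̄, is a metric space. -/

import Mathlib

open scoped ENNReal NNReal
open Metric Set Filter MeasureTheory

noncomputable section

abbrev E (N : ℕ) : Type := EuclideanSpace ℝ (Fin N)

/-- The set of costs of chains jumping through `m + 1` stitches (with consecutive
stitches distinct) from `v` to `w`. -/
def chainCosts {N : ℕ} {J : Type*} (I : J → Set (E N)) (m : ℕ) (v w : E N) :
    Set ℝ≥0∞ :=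
  {c | ∃ (j : Fin (m + 1) → J) (z z' : Fin (m + 1) → E N),
    (∀ i, z i ∈ I (j i)) ∧ (∀ i, z' i ∈ I (j i)) ∧
    (∀ i : Fin m, j i.castSucc ≠ j i.succ) ∧
    c = edist v (z 0) + (∑ i : Fin m, edist (z' i.castSucc) (z i.succ)) +
        edist (z' (Fin.last m)) w}

/-- `dk I k v w` is the infimum of lengths of paths from `v` to `w` jumping through
exactly `k` stitches (it is `∞` when no such chain exists). -/
def dk {N : ℕ} {J : Type*} (I : J → Set (E N)) : ℕ → E N → E N → ℝ≥0∞
  | 0 => fun v w => edist v w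
  | (m + 1) => fun v w => sInf (chainCosts I m v w)

/-- The smocking pseudometric `d̄`. -/
def dbar {N : ℕ} {J : Type*} (I : J → Set (E N)) (v w : E N) : ℝ≥0∞ :=
  ⨅ k, dk I k v w


section Smocking

variable {N : ℕ} {J : Type*} {I : J → Set (E N)}

/-- A function that grows at most by `edist` along jumps, and does not change inside stitches,
grows at most by `dbar`. -/
lemma le_dbar_add {f : E N → ℝ≥0∞} (hf : ∀ v w, f v ≤ edist v w + f w)
    (hI : ∀ j, ∀ z ∈ I j, ∀ z' ∈ I j, f z ≤ f z') (v w : E N) :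
    f v ≤ dbar I v w + f w := by
  have jump : ∀ v j, ∀ z ∈ I j, ∀ z' ∈ I j, f v ≤ edist v z + f z' := fun v j z hz z' hz' =>
    (hf v z).trans (add_le_add le_rfl (hI j z hz z' hz'))
  have chain : ∀ m v, ∀ c ∈ chainCosts I m v w, f v ≤ c + f w := by
    intro m
    induction m with
    | zero =>
      rintro v c ⟨j, z, z', hz, hz', -, rfl⟩
      refine (jump v (j 0) (z 0) (hz 0) (z' 0) (hz' 0)).trans ?_
      simpa [add_assoc] using add_le_add (le_refl (edist v (z 0))) (hf (z' 0) w)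
    | succ m ih =>
      rintro v c ⟨j, z, z', hz, hz', hj, rfl⟩
      refine (jump v (j 0) (z 0) (hz 0) (z' 0) (hz' 0)).trans ?_
      have h := ih (z' 0) _ ⟨fun i => j i.succ, fun i => z i.succ, fun i => z' i.succ,
        fun i => hz _, fun i => hz' _, fun i => hj i.succ, rfl⟩
      refine (add_le_add (le_refl (edist v (z 0))) h).trans (le_of_eq ?_)
      rw [Fin.sum_univ_succ]
      simp only [Fin.succ_last, Fin.castSucc_zero, Fin.succ_castSucc, add_assoc]
  rw [dbar, ENNReal.iInf_add]
  refine le_iInf fun k => ?_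
  cases k with
  | zero => exact hf v w
  | succ m =>
    simp only [dk]
    rw [sInf_eq_iInf', ENNReal.iInf_add]
    exact le_iInf fun c => chain m v c c.2

lemma dbar_le_edist (v w : E N) : dbar I v w ≤ edist v w :=
  iInf_le (fun k => dk I k v w) 0

lemma dbar_le_of_mem_chainCosts {m : ℕ} {v w : E N} {c : ℝ≥0∞} (hc : c ∈ chainCosts I m v w) :
    dbar I v w ≤ c :=
  (iInf_le (fun k => dk I k v w) (m + 1)).trans (sInf_le hc)

lemma dbar_self (v : E N) : dbar I v v = 0 :=
  le_antisymm ((dbar_le_edist v v).trans (edist_self v).le) zero_le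

lemma dbar_ne_top (v w : E N) : dbar I v w ≠ ⊤ :=
  ne_top_of_le_ne_top (edist_ne_top v w) (dbar_le_edist v w)

lemma le_dbar_of_chain {a : ℝ≥0∞} {v w : E N} (h₀ : a ≤ edist v w)
    (h : ∀ m, ∀ c ∈ chainCosts I m v w, a ≤ c) : a ≤ dbar I v w := by
  refine le_iInf fun k => ?_
  cases k with
  | zero => exact h₀
  | succ m => exact le_sInf (h m)

lemma dbar_le_edist_add (v u w : E N) : dbar I v w ≤ edist v u + dbar I u w := by
  rw [add_comm, ← tsub_le_iff_right]
  refine le_dbar_of_chain ?_ ?_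
  · rw [tsub_le_iff_left]
    exact (dbar_le_edist v w).trans (edist_triangle v u w)
  · rintro m _ ⟨j, z, z', hz, hz', hj, rfl⟩
    rw [tsub_le_iff_left]
    refine (dbar_le_of_mem_chainCosts ⟨j, z, z', hz, hz', hj, rfl⟩).trans ?_
    rw [← add_assoc, ← add_assoc]
    gcongr
    exact edist_triangle _ _ _

lemma dbar_le_of_mem {j : J} {z z' : E N} (hz : z ∈ I j) (hz' : z' ∈ I j) (w : E N) :
    dbar I z w ≤ dbar I z' w := by
  refine le_dbar_of_chain ?_ ?_
  · refine dbar_le_of_mem_chainCosts (m := 0)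
      ⟨fun _ => j, fun _ => z, fun _ => z', fun _ => hz, fun _ => hz', fun i => i.elim0, ?_⟩
    simp
  · rintro m _ ⟨i, y, y', hy, hy', hi, rfl⟩
    by_cases h : j = i 0
    · subst h
      refine (dbar_le_of_mem_chainCosts ⟨i, Function.update y 0 z, y', fun k => ?_, hy', hi,
        rfl⟩).trans ?_
      · by_cases hk : k = 0
        · subst hk; simpa using hz
        · simpa [Function.update_of_ne hk] using hy k
      · simp [add_assoc]
    · refine dbar_le_of_mem_chainCosts (m := m + 1)
        ⟨Fin.cons j i, Fin.cons z y, Fin.cons z' y', ?_, ?_, ?_, ?_⟩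
      · exact Fin.cases (by simpa using hz) (by simpa using hy)
      · exact Fin.cases (by simpa using hz') (by simpa using hy')
      · refine Fin.cases (by simpa using h) fun k => ?_
        simpa [← Fin.succ_castSucc] using hi k
      · rw [Fin.sum_univ_succ]
        simp [← Fin.succ_last]

lemma dbar_triangle (v u w : E N) : dbar I v w ≤ dbar I v u + dbar I u w :=
  le_dbar_add (f := fun x => dbar I x w) (fun v u => dbar_le_edist_add v u w)
    (fun _ _ hz _ hz' => dbar_le_of_mem hz hz' w) v u

lemma dbar_eq_zero_of_mem {j : J} {v w : E N} (hv : v ∈ I j) (hw : w ∈ I j) :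
    dbar I v w = 0 :=
  le_antisymm ((dbar_le_of_mem hv hw w).trans (dbar_self w).le) zero_le

lemma dbar_comm_le (v w : E N) : dbar I w v ≤ dbar I v w := by
  have h := le_dbar_add (I := I) (f := fun x => dbar I w x) (fun x y => ?_)
    (fun j z hz z' hz' => ?_) v w
  · simpa [dbar_self] using h
  · refine (dbar_triangle w y x).trans ?_
    rw [add_comm, edist_comm]
    gcongr
    exact dbar_le_edist y x
  · refine (dbar_triangle w z' z).trans ?_
    rw [dbar_eq_zero_of_mem hz' hz, add_zero]

lemma dbar_comm (v w : E N) : dbar I v w = dbar I w v :=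
  le_antisymm (dbar_comm_le w v) (dbar_comm_le v w)

/-- A closed set at positive distance from all the stitches that it does not contain is
saturated for the relation `dbar I v w = 0`. -/
lemma mem_of_dbar_eq_zero {C : Set (E N)} (hC : IsClosed C) {r : ℝ≥0∞} (hr : r ≠ 0)
    (hI : ∀ j, I j ⊆ C ∨ ∀ z ∈ I j, r ≤ infEDist z C) {v w : E N} (hv : v ∈ C)
    (h : dbar I v w = 0) : w ∈ C := by
  have key := le_dbar_add (I := I) (f := fun x => min (infEDist x C) r) (fun x y => ?_)
    (fun j z hz z' hz' => ?_) w v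
  · rw [dbar_comm, h, infEDist_zero_of_mem hv, zero_min, add_zero, nonpos_iff_eq_zero] at key
    have h0 : infEDist w C = 0 := by
      rcases min_choice (infEDist w C) r with h' | h'
      · exact h'.symm.trans key
      · exact absurd (h'.symm.trans key) hr
    exact hC.closure_eq ▸ mem_closure_iff_infEDist_zero.2 h0
  · rw [← min_add_add_left]
    exact min_le_min (infEDist_le_edist_add_infEDist) le_add_self
  · rcases hI j with hj | hj
    · simp [infEDist_zero_of_mem (hj hz)]
    · exact (min_le_right _ _).trans (le_min (hj z' hz') le_rfl)

lemma isClosed_iUnion_of_separated (hI : ∀ j, IsClosed (I j)) {δ : ℝ} (hδ : 0 < δ)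
    (hsep : ∀ j j', j ≠ j' → ∀ z ∈ I j, ∀ z' ∈ I j', δ ≤ dist z z') :
    IsClosed (⋃ j, I j) := by
  refine LocallyFinite.isClosed_iUnion (fun x => ⟨ball x (δ / 2), ball_mem_nhds x (by linarith),
    Set.Subsingleton.finite ?_⟩) hI
  rintro j ⟨z, hz, hzx⟩ j' ⟨z', hz', hzx'⟩
  by_contra hne
  have h₁ := hsep j j' hne z hz z' hz'
  have h₂ := dist_triangle_right z z' x
  rw [mem_ball] at hzx hzx'
  linarith

lemma dbar_eq_zero_iff (hI : ∀ j, IsClosed (I j)) {δ : ℝ} (hδ : 0 < δ)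
    (hsep : ∀ j j', j ≠ j' → ∀ z ∈ I j, ∀ z' ∈ I j', δ ≤ dist z z') (v w : E N) :
    dbar I v w = 0 ↔ v = w ∨ ∃ j, v ∈ I j ∧ w ∈ I j := by
  constructor
  · intro h
    by_cases hv : ∃ j, v ∈ I j
    · obtain ⟨j, hj⟩ := hv
      refine Or.inr ⟨j, hj, mem_of_dbar_eq_zero (hI j) (r := ENNReal.ofReal δ) (by simpa) ?_ hj h⟩
      intro i
      by_cases hij : i = j
      · exact Or.inl (by rw [hij])
      · refine Or.inr fun z hz => le_infEDist.2 fun y hy => ?_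
        rw [edist_dist]
        exact ENNReal.ofReal_le_ofReal (hsep i j hij z hz y hy)
    · have hS := isClosed_iUnion_of_separated hI hδ hsep
      have hvS : v ∉ ⋃ j, I j := by simpa using hv
      refine Or.inl (mem_of_dbar_eq_zero isClosed_singleton (r := infEDist v (⋃ j, I j))
        ?_ (fun j => Or.inr fun z hz => ?_) (mem_singleton v) h).symm
      · intro h0
        exact hvS (hS.closure_eq ▸ mem_closure_iff_infEDist_zero.2 h0)
      · rw [infEDist_singleton, edist_comm]
        exact infEDist_le_edist_of_mem (mem_iUnion_of_mem j hz)
  · rintro (rfl | ⟨j, hv, hw⟩)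
    · exact dbar_self v
    · exact dbar_eq_zero_of_mem hv hw

lemma dbar_congr_right {w w' : E N} (h : dbar I w w' = 0) (v : E N) :
    dbar I v w = dbar I v w' := by
  apply le_antisymm
  · simpa [dbar_comm w' w, h] using dbar_triangle (I := I) v w' w
  · simpa [h] using dbar_triangle (I := I) v w w'

variable (I) in
/-- The metric induced by `dbar` on the quotient identifying points at `dbar`-distance zero. -/
@[reducible] def dbarQuotMetricSpace : MetricSpace (Quot fun v w : E N => dbar I v w = 0) where
  dist := Quot.lift₂ (fun v w => (dbar I v w).toReal)
    (fun v w w' h => by rw [dbar_congr_right h])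
    (fun v v' w h => by rw [dbar_comm v w, dbar_comm v' w, dbar_congr_right h])
  dist_self := by
    rintro ⟨v⟩
    exact (congrArg ENNReal.toReal (dbar_self v)).trans ENNReal.toReal_zero
  dist_comm := by
    rintro ⟨v⟩ ⟨w⟩
    exact congrArg ENNReal.toReal (dbar_comm v w)
  dist_triangle := by
    rintro ⟨v⟩ ⟨u⟩ ⟨w⟩
    change (dbar I v w).toReal ≤ (dbar I v u).toReal + (dbar I u w).toReal
    rw [← ENNReal.toReal_add (dbar_ne_top v u) (dbar_ne_top u w)]
    exact ENNReal.toReal_mono (ENNReal.add_ne_top.2 ⟨dbar_ne_top v u, dbar_ne_top u w⟩)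
      (dbar_triangle v u w)
  eq_of_dist_eq_zero := by
    rintro ⟨v⟩ ⟨w⟩ h
    change (dbar I v w).toReal = 0 at h
    exact Quot.sound ((ENNReal.toReal_eq_zero_iff _).1 h |>.resolve_right (dbar_ne_top v w))

end Smocking

/-- `dbar v w = 0` iff `v = w` or `v` and `w` lie in a common stitch;
consequently the quotient of ℝ^N identifying the points of each stitch to a single
point, with the distance induced by `dbar`, is a metric space. -/
theorem smocking_pseudometric_eq_zero_iff
    {N : ℕ} (hN : 1 ≤ N) {J : Type} [Countable J] (I : J → Set (E N))
    (hne : ∀ j, (I j).Nonempty) (hcpt : ∀ j, IsCompact (I j))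
    (hconn : ∀ j, IsConnected (I j))
    (hdisj : Pairwise fun j j' => Disjoint (I j) (I j'))
    (hsep : ∃ δ : ℝ, 0 < δ ∧ ∀ j j', j ≠ j' → ∀ z ∈ I j, ∀ z' ∈ I j', δ ≤ dist z z') :
    (∀ v w : E N, dbar I v w = 0 ↔ v = w ∨ ∃ j, v ∈ I j ∧ w ∈ I j) ∧
    ∃ m : MetricSpace (Quot fun v w : E N => dbar I v w = 0),
      ∀ v w : E N,
        m.toPseudoMetricSpace.toDist.dist
            (Quot.mk (fun v w : E N => dbar I v w = 0) v)
            (Quot.mk (fun v w : E N => dbar I v w = 0) w)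
          = (dbar I v w).toReal := by
  obtain ⟨δ, hδ, hsep⟩ := hsep
  exact ⟨dbar_eq_zero_iff (fun j => (hcpt j).isClosed) hδ hsep,
    dbarQuotMetricSpace I, fun _ _ => rfl⟩
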